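/- Let 1 < p_1, p_2 < ∞ and define p by 1/p = 1/p_1 + 1/p_2. Define the weights on ℝ: w_1(x) = 1/(|x| (log(e/|x|))^2) for |x| ≤ 1 and w_1(x) = 1 for |x| > 1, and w_2(x) = 1 for all x. Then the pair w⃗ = (w_1, w_2) belongs to the bilinear class A_{(p_1,p_2)}, yet w_1 ∉ A_{p_1}. In particular, there exist vectors of locally integrable weights in A_{p⃗} that are not product weights arising from A_{p_i} weights. -/

import Mathlib

open MeasureTheory ENNReal

noncomputable section

/-- A (nondegenerate, compact) interval in `ℝ`. -/
def IsIntervalR (I : Set ℝ) : Prop := ∃ (c h : ℝ), 0 < h ∧ I = Set.Icc c (c + h)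

/-- The average `⨍_I f dx` of a (nonnegative) function over a set,
computed with the Lebesgue integral, valued in `ℝ≥0∞`. -/
def avgI (I : Set ℝ) (f : ℝ → ℝ) : ℝ≥0∞ :=
  (volume I)⁻¹ * ∫⁻ x in I, ENNReal.ofReal (f x)

/-- The Muckenhoupt class `A_p` on `ℝ` for `1 < p < ∞`. -/
def MuckApI (p : ℝ) (w : ℝ → ℝ) : Prop :=
  ∃ C : ℝ≥0∞, C ≠ ⊤ ∧ ∀ I : Set ℝ, IsIntervalR I →
    avgI I w * (avgI I fun x => w x ^ (1 - p / (p - 1))) ^ (p - 1) ≤ C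

/-- The reverse Hölder class `RH_s` on `ℝ` for `1 < s < ∞`. -/
def RevHolderI (s : ℝ) (w : ℝ → ℝ) : Prop :=
  ∃ C : ℝ≥0∞, C ≠ ⊤ ∧ ∀ I : Set ℝ, IsIntervalR I →
    (avgI I fun x => w x ^ s) ^ (1 / s) ≤ C * avgI I w

/-- The bilinear Muckenhoupt class `A_{(p₁,p₂)}` on `ℝ`, with
`w = w₁^{p/p₁} w₂^{p/p₂}`. -/
def BiApI (p₁ p₂ p : ℝ) (w₁ w₂ : ℝ → ℝ) : Prop :=
  ∃ C : ℝ≥0∞, C ≠ ⊤ ∧ ∀ I : Set ℝ, IsIntervalR I →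
    (avgI I fun x => w₁ x ^ (p / p₁) * w₂ x ^ (p / p₂)) ^ (1 / p) *
      (avgI I fun x => w₁ x ^ (1 - p₁ / (p₁ - 1))) ^ (1 - 1 / p₁) *
      (avgI I fun x => w₂ x ^ (1 - p₂ / (p₂ - 1))) ^ (1 - 1 / p₂) ≤ C

def W (x : ℝ) : ℝ := if |x| ≤ 1 then
      1 / (|x| * Real.log (Real.exp 1 / |x|) ^ (2 : ℕ)) else 1

lemma log_e_div {x : ℝ} (hx : 0 < x) : Real.log (Real.exp 1 / x) = 1 - Real.log x := by
  rw [Real.log_div (Real.exp_ne_zero _) hx.ne', Real.log_exp]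

lemma W_abs (x : ℝ) : W |x| = W x := by simp [W]

lemma W_zero : W 0 = 0 := by simp [W]

lemma W_of_le {x : ℝ} (hx : 0 < x) (h1 : x ≤ 1) : W x = 1 / (x * (1 - Real.log x) ^ 2) := by
  simp only [W, abs_of_pos hx, if_pos h1, log_e_div hx]

lemma W_of_gt {x : ℝ} (h1 : 1 < x) : W x = 1 := by
  simp only [W, abs_of_pos (zero_lt_one.trans h1), if_neg (not_le.2 h1)]

lemma W_one : W 1 = 1 := by rw [W_of_le one_pos le_rfl]; simp

lemma W_pos {x : ℝ} (hx : 0 < x) : 0 < W x := by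
  rcases le_or_gt x 1 with h | h
  · rw [W_of_le hx h]
    have := Real.log_nonpos hx.le h
    have : 0 < 1 - Real.log x := by linarith
    positivity
  · rw [W_of_gt h]; exact one_pos

lemma W_nonneg (x : ℝ) : 0 ≤ W x := by
  rw [← W_abs]
  rcases (abs_nonneg x).eq_or_lt with h | h
  · rw [← h, W_zero]
  · exact (W_pos h).le

/-- quasi-monotonicity -/
lemma W_quasi {s t : ℝ} (hs : 0 < s) (hst : s ≤ t) : W t ≤ 9 * W s := by
  have key : ∀ {s t : ℝ}, 0 < s → s ≤ t → t ≤ 1 → W t ≤ 9 * W s := by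
    intro s t hs hst ht
    have htp := hs.trans_le hst
    rw [W_of_le hs (hst.trans ht), W_of_le htp ht]
    have h1 := Real.log_nonpos htp.le ht
    have h2 := Real.log_le_log hs hst
    have hA : 1 ≤ 1 - Real.log t := by linarith
    have hB : 1 ≤ 1 - Real.log s := by linarith
    have hlog : Real.log t - Real.log s ≤ 2 * (√t / √s) := by
      rw [← Real.log_div htp.ne' hs.ne']
      have h3 : 0 < √t / √s := div_pos (Real.sqrt_pos.2 htp) (Real.sqrt_pos.2 hs)
      have h4 : t / s = (√t / √s) ^ 2 := by
        rw [div_pow, Real.sq_sqrt htp.le, Real.sq_sqrt hs.le]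
      have h5 := Real.log_le_sub_one_of_pos h3
      rw [h4, Real.log_pow]; push_cast; linarith
    have hsp := Real.sqrt_pos.2 hs
    have hsq := Real.sqrt_le_sqrt hst
    have hlog' : √s * (Real.log t - Real.log s) ≤ 2 * √t := by
      have := mul_le_mul_of_nonneg_left hlog hsp.le
      calc _ ≤ _ := this
        _ = _ := by field_simp
    have h6 : √s * (1 - Real.log s) ≤ 3 * (√t * (1 - Real.log t)) := by
      nlinarith
    have h7 : (√s * (1 - Real.log s)) ^ 2 ≤ (3 * (√t * (1 - Real.log t))) ^ 2 :=
      pow_le_pow_left₀ (by positivity) h6 2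
    rw [mul_pow, mul_pow, mul_pow, Real.sq_sqrt htp.le, Real.sq_sqrt hs.le] at h7
    rw [mul_one_div, div_le_div_iff₀ (by positivity) (by positivity)]
    linarith
  rcases le_or_gt t 1 with h | h
  · exact key hs hst h
  · rw [W_of_gt h]
    rcases le_or_gt s 1 with h' | h'
    · have := key hs h' le_rfl
      rwa [W_one] at this
    · rw [W_of_gt h']; norm_num

lemma W_growth {s t : ℝ} (hs : 0 < s) (hst : s ≤ t) : W s ≤ t / s * W t := by
  have key : ∀ {s t : ℝ}, 0 < s → s ≤ t → t ≤ 1 → W s ≤ t / s * W t := by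
    intro s t hs hst ht
    have htp := hs.trans_le hst
    rw [W_of_le hs (hst.trans ht), W_of_le htp ht]
    have h1 := Real.log_nonpos htp.le ht
    have h2 := Real.log_le_log hs hst
    have hA : 1 ≤ 1 - Real.log t := by linarith
    have hB : 1 ≤ 1 - Real.log s := by linarith
    have : t / s * (1 / (t * (1 - Real.log t) ^ 2)) = 1 / (s * (1 - Real.log t) ^ 2) := by
      field_simp
    rw [this]
    gcongr
  rcases le_or_gt t 1 with h | h
  · exact key hs hst h
  · rw [W_of_gt h]
    rcases le_or_gt s 1 with h' | h'
    · have := key hs h' le_rfl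
      rw [W_one] at this
      refine this.trans ?_
      gcongr
    · rw [W_of_gt h', mul_one, one_le_div hs]; exact hst

lemma lint_rpow {θ M : ℝ} (hθ : θ < 1) (hM : 0 < M) :
    ∫⁻ x in Set.Icc (-M) M, ENNReal.ofReal (|x| ^ (-θ)) ≤
      ENNReal.ofReal (2 * (M ^ (1 - θ) / (1 - θ))) := by
  have hpos : ∫⁻ x in Set.Icc 0 M, ENNReal.ofReal (|x| ^ (-θ)) =
      ENNReal.ofReal (M ^ (1 - θ) / (1 - θ)) := by
    have hint : IntegrableOn (fun x : ℝ => x ^ (-θ)) (Set.Ioc 0 M) := by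
      rw [← intervalIntegrable_iff_integrableOn_Ioc_of_le hM.le]
      exact intervalIntegral.intervalIntegrable_rpow' (by linarith)
    rw [setLIntegral_congr (Ioc_ae_eq_Icc (a := (0:ℝ)) (b := M)).symm]
    have h1 : ∫⁻ x in Set.Ioc 0 M, ENNReal.ofReal (|x| ^ (-θ)) =
        ∫⁻ x in Set.Ioc 0 M, ENNReal.ofReal (x ^ (-θ)) :=
      setLIntegral_congr_fun measurableSet_Ioc (fun x hx => by simp only [abs_of_pos hx.1])
    rw [h1, ← ofReal_integral_eq_lintegral_ofReal hint
      (ae_restrict_of_forall_mem measurableSet_Ioc (fun x hx => Real.rpow_nonneg hx.1.le _)),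
      ← intervalIntegral.integral_of_le hM.le, integral_rpow (Or.inl (by linarith)),
      Real.zero_rpow (by linarith), sub_zero]
    congr 2 <;> ring_nf
  have hneg : ∫⁻ x in Set.Icc (-M) 0, ENNReal.ofReal (|x| ^ (-θ)) =
      ENNReal.ofReal (M ^ (1 - θ) / (1 - θ)) := by
    rw [← hpos]
    have := (Measure.measurePreserving_neg (volume : Measure ℝ)).setLIntegral_comp_preimage_emb
      (MeasurableEquiv.neg ℝ).measurableEmbedding
      (fun x => ENNReal.ofReal (|x| ^ (-θ))) (Set.Icc 0 M)
    simpa using this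
  calc _ ≤ ∫⁻ x in Set.Icc (-M) 0 ∪ Set.Icc 0 M, ENNReal.ofReal (|x| ^ (-θ)) :=
        lintegral_mono_set Set.Icc_subset_Icc_union_Icc
    _ ≤ _ := lintegral_union_le _ _ _
    _ = _ := by
        have : 0 ≤ M ^ (1 - θ) / (1 - θ) := div_nonneg (by positivity) (by linarith)
        rw [hpos, hneg, ← ENNReal.ofReal_add this this, two_mul]

lemma avg_le_of_le {c h K : ℝ} (hh : 0 < h) {f : ℝ → ℝ}
    (hf : ∀ x ∈ Set.Icc c (c + h), f x ≤ K) : avgI (Set.Icc c (c + h)) f ≤ ENNReal.ofReal K := by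
  unfold avgI
  have h1 : ∫⁻ x in Set.Icc c (c + h), ENNReal.ofReal (f x) ≤
      ∫⁻ x in Set.Icc c (c + h), ENNReal.ofReal K :=
    setLIntegral_mono' measurableSet_Icc (fun x hx => ENNReal.ofReal_le_ofReal (hf x hx))
  have hv : volume (Set.Icc c (c + h)) = ENNReal.ofReal h := by simp
  rw [setLIntegral_const, hv] at h1
  rw [hv]
  have h0 : ENNReal.ofReal h ≠ 0 := by simpa using hh
  calc _ ≤ (ENNReal.ofReal h)⁻¹ * (ENNReal.ofReal K * ENNReal.ofReal h) := by gcongr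
    _ = ENNReal.ofReal K := by
      rw [mul_comm (ENNReal.ofReal K), ← mul_assoc, ENNReal.inv_mul_cancel h0 ENNReal.ofReal_ne_top,
        one_mul]

lemma avg_rpow {θ c h M : ℝ} (h0 : 0 < θ) (hθ : θ < 1) (hh : 0 < h) (hM : M = max |c| |c + h|)
    (hMp : 0 < M) :
    avgI (Set.Icc c (c + h)) (fun x => |x| ^ (-θ)) ≤ ENNReal.ofReal (4 / (1 - θ) * M ^ (-θ)) := by
  have hxM : ∀ x ∈ Set.Icc c (c + h), |x| ≤ M := fun x hx => hM ▸ abs_le_max_abs_abs hx.1 hx.2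
  have h1θ : 0 < 1 - θ := by linarith
  rcases le_or_gt (M / 2) h with hc | hc
  · unfold avgI
    have hv : volume (Set.Icc c (c + h)) = ENNReal.ofReal h := by simp
    rw [hv]
    calc _ ≤ (ENNReal.ofReal h)⁻¹ * ∫⁻ x in Set.Icc (-M) M, ENNReal.ofReal (|x| ^ (-θ)) := by
          gcongr _ * ?_
          apply lintegral_mono_set
          intro x hx
          exact abs_le.1 (hxM x hx)
      _ ≤ (ENNReal.ofReal h)⁻¹ * ENNReal.ofReal (2 * (M ^ (1 - θ) / (1 - θ))) := by
          gcongr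
          exact lint_rpow hθ hMp
      _ = ENNReal.ofReal (h⁻¹ * (2 * (M ^ (1 - θ) / (1 - θ)))) := by
          rw [← ENNReal.ofReal_inv_of_pos hh, ← ENNReal.ofReal_mul (by positivity)]
      _ ≤ _ := by
          apply ENNReal.ofReal_le_ofReal
          have e : M ^ (1 - θ) = M * M ^ (-θ) := by
            rw [sub_eq_add_neg, Real.rpow_add hMp, Real.rpow_one]
          calc _ ≤ (M / 2)⁻¹ * (2 * (M ^ (1 - θ) / (1 - θ))) := by gcongr
            _ = _ := by rw [e]; field_simp; norm_num
  · apply avg_le_of_le hh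
    intro x hx
    have hlow : M / 2 ≤ |x| := by
      have : M ≤ |x| + h := by
        rw [hM]
        apply max_le
        · have := abs_sub_abs_le_abs_sub c x
          have : |c - x| ≤ h := abs_le.2 ⟨by linarith [hx.2], by linarith [hx.1]⟩
          linarith
        · have := abs_sub_abs_le_abs_sub (c + h) x
          have : |c + h - x| ≤ h := abs_le.2 ⟨by linarith [hx.2], by linarith [hx.1]⟩
          linarith
      linarith
    calc |x| ^ (-θ) ≤ (M / 2) ^ (-θ) :=
          Real.rpow_le_rpow_of_nonpos (by positivity) hlow (by linarith)
      _ = 2 ^ θ * M ^ (-θ) := by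
          rw [Real.div_rpow hMp.le (by norm_num), Real.rpow_neg (by norm_num : (0:ℝ) ≤ 2)]
          field_simp
      _ ≤ _ := by
          gcongr
          have h2 : (2:ℝ) ^ θ ≤ 2 ^ (1:ℝ) := Real.rpow_le_rpow_of_exponent_le (by norm_num) hθ.le
          rw [Real.rpow_one] at h2
          refine h2.trans ?_
          rw [le_div_iff₀ h1θ]; linarith

lemma part1 (p₁ p₂ p : ℝ) (hp₁ : 1 < p₁) (hp₂ : 1 < p₂)
    (hp : 1 / p = 1 / p₁ + 1 / p₂) : BiApI p₁ p₂ p W (fun _ => 1) := by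
  have hp1 : 0 < p₁ := by linarith
  have hp2 : 0 < p₂ := by linarith
  have hpp : 0 < p := by
    have : 0 < 1 / p := by rw [hp]; positivity
    exact one_div_pos.1 this
  set θ := p / p₁ with hθd
  have hθ0 : 0 < θ := by positivity
  have hθ1 : θ < 1 := by
    rw [hθd, div_lt_one hp1]
    apply lt_of_one_div_lt_one_div hp1
    rw [hp]
    have : 0 < 1 / p₂ := by positivity
    linarith
  set a := p₁ / (p₁ - 1) - 1 with had
  have hp11 : 0 < p₁ - 1 := by linarith
  have ha : a = 1 / (p₁ - 1) := by rw [had]; field_simp; ring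
  have ha0 : 0 < a := by rw [ha]; positivity
  have hae : 1 - p₁ / (p₁ - 1) = -a := by rw [had]; ring
  rw [BiApI, hae]
  have h1θ : 0 < 1 - θ := by linarith
  refine ⟨ENNReal.ofReal ((4 / (1 - θ)) ^ (1 / p) * 9 ^ (1 / p₁)), ENNReal.ofReal_ne_top, ?_⟩
  rintro I ⟨c, h, hh, rfl⟩
  set M := max |c| |c + h| with hM
  have hMp : 0 < M := by
    by_contra hcon
    have h1 : |c| ≤ M := le_max_left _ _
    have h2 : |c + h| ≤ M := le_max_right _ _
    have h3 := abs_nonneg c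
    have h4 : |c| = 0 := by linarith
    have h5 : |c + h| = 0 := le_antisymm (by linarith) (abs_nonneg _)
    rw [abs_eq_zero] at h4 h5
    linarith
  have hxM : ∀ x ∈ Set.Icc c (c + h), |x| ≤ M := fun x hx => abs_le_max_abs_abs hx.1 hx.2
  have hWM := W_pos hMp
  have hC : avgI (Set.Icc c (c + h)) (fun x => (fun _ => (1:ℝ)) x ^ (1 - p₂ / (p₂ - 1))) ≤ 1 := by
    rw [← ENNReal.ofReal_one]
    exact avg_le_of_le hh (fun x _ => by simp)
  have hB : avgI (Set.Icc c (c + h)) (fun x => W x ^ (-a)) ≤ ENNReal.ofReal ((9 / W M) ^ a) := by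
    apply avg_le_of_le hh
    intro x hx
    rcases eq_or_ne x 0 with rfl | hx0
    · rw [W_zero, Real.zero_rpow (by linarith)]; positivity
    · have hxp := abs_pos.2 hx0
      have := W_quasi hxp (hxM x hx)
      have hW := W_pos hxp
      rw [W_abs] at this hW
      rw [Real.rpow_neg hW.le, ← Real.inv_rpow hW.le]
      apply Real.rpow_le_rpow (by positivity) _ ha0.le
      rw [inv_le_comm₀ hW (by positivity), inv_div, div_le_iff₀ (by norm_num)]
      linarith
  have hA : avgI (Set.Icc c (c + h)) (fun x => W x ^ θ * (fun _ => (1:ℝ)) x ^ (p / p₂)) ≤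
      ENNReal.ofReal (W M ^ θ * (4 / (1 - θ))) := by
    have h1 : avgI (Set.Icc c (c + h)) (fun x => W x ^ θ * (fun _ => (1:ℝ)) x ^ (p / p₂)) ≤
        ENNReal.ofReal (W M ^ θ * M ^ θ) * avgI (Set.Icc c (c + h)) (fun x => |x| ^ (-θ)) := by
      unfold avgI
      rw [mul_left_comm, ← lintegral_const_mul' _ _ ENNReal.ofReal_ne_top]
      gcongr _ * ?_
      apply setLIntegral_mono' measurableSet_Icc
      intro x hx
      rw [← ENNReal.ofReal_mul (by positivity)]
      apply ENNReal.ofReal_le_ofReal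
      simp only [Real.one_rpow, mul_one]
      rcases eq_or_ne x 0 with rfl | hx0
      · rw [W_zero, Real.zero_rpow hθ0.ne']; positivity
      · have hxp := abs_pos.2 hx0
        have h2 := W_growth hxp (hxM x hx)
        rw [W_abs] at h2
        calc W x ^ θ ≤ (M / |x| * W M) ^ θ := Real.rpow_le_rpow (W_nonneg x) h2 hθ0.le
          _ = _ := by
            rw [Real.mul_rpow (by positivity) hWM.le, Real.div_rpow hMp.le hxp.le,
              Real.rpow_neg hxp.le]
            ring
    refine h1.trans ?_
    refine (mul_le_mul_right (avg_rpow hθ0 hθ1 hh hM hMp) _).trans ?_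
    rw [← ENNReal.ofReal_mul (by positivity)]
    apply ENNReal.ofReal_le_ofReal
    rw [Real.rpow_neg hMp.le]
    apply le_of_eq
    have : M ^ θ ≠ 0 := (Real.rpow_pos_of_pos hMp _).ne'
    field_simp
  have e1 : 0 ≤ 1 - 1 / p₁ := by
    rw [sub_nonneg, div_le_one hp1]; exact hp₁.le
  have e2 : 0 ≤ 1 - 1 / p₂ := by
    rw [sub_nonneg, div_le_one hp2]; exact hp₂.le
  calc _ ≤ (ENNReal.ofReal (W M ^ θ * (4 / (1 - θ)))) ^ (1 / p) *
        (ENNReal.ofReal ((9 / W M) ^ a)) ^ (1 - 1 / p₁) * 1 ^ (1 - 1 / p₂) := by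
        gcongr
    _ = ENNReal.ofReal ((W M ^ θ * (4 / (1 - θ))) ^ (1 / p) * ((9 / W M) ^ a) ^ (1 - 1 / p₁)) := by
        rw [ENNReal.one_rpow, mul_one, ENNReal.ofReal_rpow_of_nonneg (by positivity) (by positivity),
          ENNReal.ofReal_rpow_of_nonneg (by positivity) e1, ← ENNReal.ofReal_mul (by positivity)]
    _ = _ := by
        congr 1
        rw [Real.mul_rpow (by positivity) (by positivity), ← Real.rpow_mul hWM.le,
          ← Real.rpow_mul (by positivity)]
        have f1 : θ * (1 / p) = 1 / p₁ := by rw [hθd]; field_simp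
        have f2 : a * (1 - 1 / p₁) = 1 / p₁ := by rw [ha]; field_simp
        rw [f1, f2, Real.div_rpow (by norm_num) hWM.le]
        have : W M ^ (1 / p₁) ≠ 0 := (Real.rpow_pos_of_pos hWM _).ne'
        field_simp

/-- antiderivative -/
def G (x : ℝ) : ℝ := if x ≤ 0 then 0 else (1 - Real.log x)⁻¹

lemma G_cont {r : ℝ} (h1 : r ≤ 1) : ContinuousOn G (Set.Icc 0 r) := by
  intro x hx
  rcases hx.1.eq_or_lt with h | h
  · subst h
    apply ContinuousAt.continuousWithinAt
    have hG0 : G 0 = 0 := by simp [G]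
    have hs : nhds (0:ℝ) = nhdsWithin 0 (Set.Iic 0) ⊔ nhdsWithin 0 (Set.Ioi 0) :=
      (nhdsLE_sup_nhdsGT (0:ℝ)).symm
    suffices h : Filter.Tendsto G (nhdsWithin 0 (Set.Iic 0) ⊔ nhdsWithin 0 (Set.Ioi 0)) (nhds 0) by
      rw [ContinuousAt, hG0]
      rwa [← hs] at h
    rw [Filter.tendsto_sup]
    constructor
    · apply tendsto_const_nhds.congr'
      filter_upwards [self_mem_nhdsWithin] with y hy
      simp only [G, if_pos (Set.mem_Iic.1 hy)]
    · have : Filter.Tendsto (fun y => (1 - Real.log y)⁻¹) (nhdsWithin 0 (Set.Ioi 0)) (nhds 0) := by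
        apply Filter.Tendsto.inv_tendsto_atTop
        have := Filter.tendsto_neg_atBot_atTop.comp Real.tendsto_log_nhdsGT_zero
        exact (Filter.tendsto_atTop_add_const_left _ 1 this).congr (fun y => by simp [sub_eq_add_neg])
      apply this.congr'
      filter_upwards [self_mem_nhdsWithin] with y hy
      simp only [G, if_neg (not_le.2 (Set.mem_Ioi.1 hy))]
  · apply ContinuousAt.continuousWithinAt
    have : ContinuousAt (fun y => (1 - Real.log y)⁻¹) x := by
      have := Real.log_nonpos h.le (hx.2.trans h1)
      exact ((continuousAt_const.sub (Real.continuousAt_log h.ne')).inv₀ (by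
        simp only [Pi.sub_apply]; linarith))
    apply this.congr
    filter_upwards [lt_mem_nhds h] with y hy
    simp only [G, if_neg (not_le.2 hy)]

lemma G_deriv {r : ℝ} (h1 : r ≤ 1) : ∀ x ∈ Set.Ioo 0 r, HasDerivAt G (W x) x := by
  intro x hx
  have hl := Real.log_nonpos hx.1.le (hx.2.le.trans h1)
  have hne : 1 - Real.log x ≠ 0 := by linarith
  have := ((Real.hasDerivAt_log hx.1.ne').const_sub 1).inv hne
  rw [W_of_le hx.1 (hx.2.le.trans h1)]
  have h2 : -(-x⁻¹) / (1 - Real.log x) ^ 2 = 1 / (x * (1 - Real.log x) ^ 2) := by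
    have := hx.1.ne'
    field_simp
  rw [h2] at this
  apply this.congr_of_eventuallyEq
  filter_upwards [lt_mem_nhds hx.1] with y hy
  simp [G, if_neg (not_le.2 hy)]

lemma W_intOn {r : ℝ} (_h0 : 0 ≤ r) (h1 : r ≤ 1) : IntegrableOn W (Set.Ioc 0 r) :=
  intervalIntegral.integrableOn_deriv_of_nonneg (G_cont h1) (G_deriv h1) (fun x _ => W_nonneg x)

lemma W_lint {r : ℝ} (h0 : 0 < r) (h1 : r ≤ 1) :
    ∫⁻ x in Set.Icc 0 r, ENNReal.ofReal (W x) = ENNReal.ofReal ((1 - Real.log r)⁻¹) := by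
  rw [setLIntegral_congr (Ioc_ae_eq_Icc (a := (0:ℝ)) (b := r)).symm,
    ← ofReal_integral_eq_lintegral_ofReal (W_intOn h0.le h1)
      (Filter.Eventually.of_forall (fun x => W_nonneg x)), ← intervalIntegral.integral_of_le h0.le,
      intervalIntegral.integral_eq_sub_of_hasDerivAt_of_le h0.le (G_cont h1) (G_deriv h1)
        ((intervalIntegrable_iff_integrableOn_Ioc_of_le h0.le).2 (W_intOn h0.le h1))]
  simp [G, not_le.2 h0]

lemma W_locInt : LocallyIntegrable W volume := by
  have hp : IntegrableOn W (Set.Icc 0 1) := by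
    rw [integrableOn_Icc_iff_integrableOn_Ioc]
    exact W_intOn zero_le_one le_rfl
  have hn : IntegrableOn W (Set.Icc (-1) 0) := by
    have := ((Measure.measurePreserving_neg (volume : Measure ℝ)).integrableOn_comp_preimage
      (MeasurableEquiv.neg ℝ).measurableEmbedding (f := W) (s := Set.Icc 0 1)).2 hp
    have e : W ∘ Neg.neg = W := by
      funext x; simp only [Function.comp]; rw [← W_abs, abs_neg, W_abs]
    rw [e] at this
    simpa using this
  have h : IntegrableOn W (Set.Icc (-1) 1) := by
    rw [← Set.Icc_union_Icc_eq_Icc (b := (0:ℝ)) (by norm_num) (by norm_num)]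
    exact hn.union hp
  have e : W = (Set.Icc (-1) 1).indicator W + (Set.Icc (-1) 1)ᶜ.indicator (fun _ => (1:ℝ)) := by
    funext x
    by_cases hx : x ∈ Set.Icc (-1:ℝ) 1
    · simp [hx]
    · have : ¬ |x| ≤ 1 := fun h => hx (abs_le.1 h)
      simp only [Pi.add_apply, Set.indicator_of_notMem hx, Set.indicator_of_mem (Set.mem_compl hx)]
      simp [W, this]
  rw [e]
  exact (h.integrable_indicator measurableSet_Icc).locallyIntegrable.add
    ((locallyIntegrable_const 1).indicator measurableSet_Icc.compl)

lemma part3 (p₁ : ℝ) (hp₁ : 1 < p₁) : ¬ MuckApI p₁ W := by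
  rintro ⟨C, hC, H⟩
  have hp11 : 0 < p₁ - 1 := by linarith
  set a := p₁ / (p₁ - 1) - 1 with had
  have ha : a = 1 / (p₁ - 1) := by rw [had]; field_simp; ring
  have ha0 : 0 < a := by rw [ha]; positivity
  have hae : 1 - p₁ / (p₁ - 1) = -a := by rw [had]; ring
  rw [hae] at H
  have key : ∀ r : ℝ, 0 < r → r ≤ 1 →
      (1 / 2) ^ (p₁ - 1) * (1 / 2) * (1 - Real.log r) ≤ C.toReal := by
    intro r h0 h1
    have hl := Real.log_nonpos h0.le h1
    have hL : 0 < 1 - Real.log r := by linarith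
    have := H (Set.Icc 0 r) ⟨0, r, h0, by simp⟩
    have hv : volume (Set.Icc 0 r) = ENNReal.ofReal r := by simp
    have hA : avgI (Set.Icc 0 r) W = ENNReal.ofReal (r⁻¹ * (1 - Real.log r)⁻¹) := by
      rw [avgI, W_lint h0 h1, hv, ← ENNReal.ofReal_inv_of_pos h0,
        ← ENNReal.ofReal_mul (by positivity)]
    have hB : ENNReal.ofReal (1 / 2 * (r / 2 * (1 - Real.log r) ^ 2) ^ a) ≤
        avgI (Set.Icc 0 r) (fun x => W x ^ (-a)) := by
      rw [avgI, hv]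
      calc _ = (ENNReal.ofReal r)⁻¹ * ∫⁻ x in Set.Icc (r / 2) r,
            ENNReal.ofReal ((r / 2 * (1 - Real.log r) ^ 2) ^ a) := by
            rw [setLIntegral_const, Real.volume_Icc, ← ENNReal.ofReal_inv_of_pos h0,
              ← ENNReal.ofReal_mul (by positivity), ← ENNReal.ofReal_mul (by positivity)]
            congr 1
            field_simp
            norm_num
        _ ≤ (ENNReal.ofReal r)⁻¹ * ∫⁻ x in Set.Icc (r / 2) r, ENNReal.ofReal (W x ^ (-a)) := by
            gcongr _ * ?_
            apply setLIntegral_mono' measurableSet_Icc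
            intro x hx
            apply ENNReal.ofReal_le_ofReal
            have hx0 : 0 < x := by linarith [hx.1]
            have hlx := Real.log_le_log hx0 hx.2
            rw [Real.rpow_neg (W_nonneg x), ← Real.inv_rpow (W_nonneg x),
              W_of_le hx0 (hx.2.trans h1), one_div, inv_inv]
            have := hx.1
            gcongr
        _ ≤ _ := by
            gcongr
            linarith
    have h2 : ENNReal.ofReal (r⁻¹ * (1 - Real.log r)⁻¹) *
        (ENNReal.ofReal (1 / 2 * (r / 2 * (1 - Real.log r) ^ 2) ^ a)) ^ (p₁ - 1) ≤ C := by
      rw [← hA]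
      refine le_trans ?_ this
      gcongr
    rw [ENNReal.ofReal_rpow_of_nonneg (by positivity) hp11.le,
      ← ENNReal.ofReal_mul (by positivity), ENNReal.ofReal_le_iff_le_toReal hC] at h2
    refine le_trans (le_of_eq ?_) h2
    have f : a * (p₁ - 1) = 1 := by rw [ha]; field_simp
    rw [Real.mul_rpow (by positivity) (by positivity), ← Real.rpow_mul (by positivity), f,
      Real.rpow_one]
    field_simp
  set k : ℝ := (1 / 2) ^ (p₁ - 1) * (1 / 2) with hk
  have hk0 : 0 < k := by positivity
  have hc0 : 0 ≤ C.toReal / k := by positivity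
  have := key (Real.exp (-(C.toReal / k))) (Real.exp_pos _) (Real.exp_le_one_iff.2 (by linarith))
  rw [Real.log_exp] at this
  have e : k * (1 - -(C.toReal / k)) = k + C.toReal := by field_simp; ring
  linarith

/-- With `w₁(x) = 1/(|x| (log(e/|x|))²)` on `[-1,1]`, `1` elsewhere, and `w₂ ≡ 1`,
the pair `(w₁, w₂)` is in `A_{(p₁,p₂)}`, `w₁` is locally integrable, yet
`w₁ ∉ A_{p₁}`. -/
theorem bilinear_Ap_not_product (p₁ p₂ p : ℝ) (hp₁ : 1 < p₁) (hp₂ : 1 < p₂)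
    (hp : 1 / p = 1 / p₁ + 1 / p₂)
    (w₁ w₂ : ℝ → ℝ)
    (hw₁ : ∀ x, w₁ x = if |x| ≤ 1 then
      1 / (|x| * Real.log (Real.exp 1 / |x|) ^ (2 : ℕ)) else 1)
    (hw₂ : ∀ x, w₂ x = 1) :
    BiApI p₁ p₂ p w₁ w₂ ∧ LocallyIntegrable w₁ volume ∧ ¬ MuckApI p₁ w₁ := by
  have e1 : w₁ = W := funext hw₁
  have e2 : w₂ = fun _ => 1 := funext hw₂
  subst e1 e2
  exact ⟨part1 p₁ p₂ p hp₁ hp₂ hp, W_locInt, part3 p₁ hp₁⟩
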